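/- Let k be an algebraically closed field of characteristic p = 3 and let R = k⟦x,y,z⟧/(z^2 + x^3 + y^4) (the rational double point of type E_6^0 in characteristic 3). With L and A as in the context: (i) the image of z/(xy) in L does not lie in A; (ii) (z/(xy))^3 lies in A; (iii) for every c ∈ L such that c^{3^m} ∈ A for some m ≥ 0, there exists a ∈ k such that c − a·(z/(xy)) ∈ A. In other words, H^2_m(R)[F^∞] is the one-dimensional k-vector space spanned by the class of z/(xy), annihilated by Frobenius. -/

import Mathlib

set_option maxHeartbeats 1000000
set_option synthInstance.maxHeartbeats 400000

open MvPowerSeries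

noncomputable section

variable (k : Type) [Field k]

/-- The formal power series ring `k⟦x,y,z⟧`. -/
abbrev PS := MvPowerSeries (Fin 3) k

/-- The hypersurface singularity `R = k⟦x,y,z⟧/(f)`. -/
abbrev Rq (f : PS k) : Type := PS k ⧸ Ideal.span {f}

/-- The image of `x` in `R`. -/
abbrev xR (f : PS k) : Rq k f := Ideal.Quotient.mk _ (X 0)
/-- The image of `y` in `R`. -/
abbrev yR (f : PS k) : Rq k f := Ideal.Quotient.mk _ (X 1)
/-- The image of `z` in `R`. -/
abbrev zR (f : PS k) : Rq k f := Ideal.Quotient.mk _ (X 2)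

/-- `L`: the localization of `R` inverting `x*y`. -/
abbrev Lloc (f : PS k) : Type := Localization.Away (xR k f * yR k f)

/-- The canonical map from the localization of `R` inverting `x` to `L`. -/
noncomputable def phiX (f : PS k) : Localization.Away (xR k f) →+* Lloc k f :=
  IsLocalization.Away.awayToAwayRight (S := Localization.Away (xR k f)) (P := Lloc k f)
    (xR k f) (yR k f)

/-- The canonical map from the localization of `R` inverting `y` to `L`. -/
noncomputable def phiY (f : PS k) : Localization.Away (yR k f) →+* Lloc k f :=
  IsLocalization.Away.awayToAwayLeft (S := Localization.Away (yR k f)) (P := Lloc k f)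
    (yR k f) (xR k f)

/-- `A ⊆ L`: the `R`-submodule generated by the images of `R_x` and `R_y` in `L`.
The quotient `L/A` is a Čech description of the local cohomology `H^2_m(R)`. -/
def Asub (f : PS k) : Submodule (Rq k f) (Lloc k f) :=
  Submodule.span (Rq k f) (Set.range (phiX k f) ∪ Set.range (phiY k f))

/-- The element `z/(x*y) ∈ L`. -/
noncomputable def zxy (f : PS k) : Lloc k f :=
  Localization.mk (zR k f) ⟨xR k f * yR k f, Submonoid.mem_powers _⟩

/-- The element `f_j := z/(x*y^j) = z*x^(j-1)/(x*y)^j ∈ L` (for `j ≥ 1`). -/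
noncomputable def fcls (f : PS k) (j : ℕ) : Lloc k f :=
  Localization.mk (zR k f * xR k f ^ (j - 1)) ⟨(xR k f * yR k f) ^ j, j, rfl⟩

/-- The defining equation of the rational double point of type E6p0 in characteristic 3. -/
abbrev fRDP : PS k := X 2 ^ 2 + X 0 ^ 3 + X 1 ^ 4

/-- The ideal `(x^n, y^n)` of `k[x,y]`. -/
abbrev polyPowIdeal (k : Type) [Field k] (n : ℕ) : Ideal (MvPolynomial (Fin 2) k) :=
  Ideal.span {MvPolynomial.X 0 ^ n, MvPolynomial.X 1 ^ n}

theorem mem_polyPowIdeal_iff {k : Type} [Field k] {n : ℕ} {g : MvPolynomial (Fin 2) k} :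
    g ∈ polyPowIdeal k n ↔ ∀ m : Fin 2 →₀ ℕ, m 0 < n → m 1 < n → g.coeff m = 0 := by
  have hspan : ({(MvPolynomial.X 0 : MvPolynomial (Fin 2) k) ^ n, MvPolynomial.X 1 ^ n} :
      Set (MvPolynomial (Fin 2) k)) = (fun s => MvPolynomial.monomial s (1 : k)) ''
        {Finsupp.single 0 n, Finsupp.single 1 n} := by
    simp [Set.image_insert_eq, MvPolynomial.X_pow_eq_monomial]
  rw [polyPowIdeal, hspan, MvPolynomial.mem_ideal_span_monomial_image]
  simp only [MvPolynomial.mem_support_iff, Set.mem_insert_iff, Set.mem_singleton_iff,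
    exists_eq_or_imp, exists_eq_left, Finsupp.single_le_iff]
  refine forall_congr' fun m => ?_
  by_cases h : g.coeff m = 0
  · simp [h]
  · simp only [ne_eq, h, not_false_eq_true, forall_const, imp_false]
    omega

theorem coeff_cube_smul {σ k : Type*} [Field k] [CharP k 3] (g : MvPolynomial σ k)
    (m : σ →₀ ℕ) : (g ^ 3).coeff (3 • m) = g.coeff m ^ 3 := by
  have : Fact (Nat.Prime 3) := ⟨Nat.prime_three⟩
  rw [← MvPolynomial.map_frobenius_expand, MvPolynomial.coeff_map,
    MvPolynomial.coeff_expand_smul _ three_ne_zero, frobenius_def]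

theorem coeff_cube_of_not_dvd {σ k : Type*} [Field k] [CharP k 3] (g : MvPolynomial σ k)
    {m : σ →₀ ℕ} {i : σ} (h : ¬ 3 ∣ m i) : (g ^ 3).coeff m = 0 := by
  have : Fact (Nat.Prime 3) := ⟨Nat.prime_three⟩
  rw [← MvPolynomial.map_frobenius_expand, MvPolynomial.coeff_map,
    MvPolynomial.coeff_expand_of_not_dvd _ h, map_zero]

theorem mem_polyPowIdeal_of_cube_mem {k : Type} [Field k] [CharP k 3] {n : ℕ}
    {g : MvPolynomial (Fin 2) k} (h : g ^ 3 ∈ polyPowIdeal k (3 * n)) : g ∈ polyPowIdeal k n := by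
  rw [mem_polyPowIdeal_iff] at h ⊢
  intro m h0 h1
  have := h (3 • m) (by simpa using h0) (by simpa using h1)
  rwa [coeff_cube_smul, pow_eq_zero_iff three_ne_zero] at this

theorem X_mul_X_pow_eq_monomial {k : Type} [Field k] (n : ℕ) :
    ((MvPolynomial.X 0 * MvPolynomial.X 1) ^ n : MvPolynomial (Fin 2) k) =
      MvPolynomial.monomial (Finsupp.single 0 n + Finsupp.single 1 n) 1 := by
  rw [mul_pow, MvPolynomial.X_pow_eq_monomial, MvPolynomial.X_pow_eq_monomial,
    MvPolynomial.monomial_mul, one_mul]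

theorem mem_polyPowIdeal_of_mul_mem {k : Type} [Field k] {n j : ℕ} {g : MvPolynomial (Fin 2) k}
    (h : (MvPolynomial.X 0 * MvPolynomial.X 1) ^ j * g ∈ polyPowIdeal k (n + j)) :
    g ∈ polyPowIdeal k n := by
  rw [mem_polyPowIdeal_iff] at h ⊢
  intro m h0 h1
  have := h (Finsupp.single 0 j + Finsupp.single 1 j + m) (by simp; omega) (by simp; omega)
  rwa [X_mul_X_pow_eq_monomial, MvPolynomial.coeff_monomial_mul, one_mul] at this

/-- Multiplication by `(x^3 + y^4)` after cubing is injective on `k[x,y]/(x^n, y^n)` up to the socle,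
even modulo the socle of `k[x,y]/(x^(3n), y^(3n))`. -/
theorem exists_sub_socle_mem {k : Type} [Field k] [CharP k 3] {n : ℕ}
    {g : MvPolynomial (Fin 2) k} {a : k}
    (h : (MvPolynomial.X 0 ^ 3 + MvPolynomial.X 1 ^ 4) * g ^ 3 +
      MvPolynomial.C a * (MvPolynomial.X 0 * MvPolynomial.X 1) ^ (3 * n + 2) ∈
        polyPowIdeal k (3 * (n + 1))) :
    ∃ b : k, g - MvPolynomial.C b * (MvPolynomial.X 0 * MvPolynomial.X 1) ^ n ∈
      polyPowIdeal k (n + 1) := by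
  classical
  rw [mem_polyPowIdeal_iff] at h
  have hne : ∀ m : Fin 2 →₀ ℕ, ∀ i N, m i ≠ N →
      ((MvPolynomial.X 0 * MvPolynomial.X 1) ^ N : MvPolynomial (Fin 2) k).coeff m = 0 := by
    intro m i N hm
    rw [X_mul_X_pow_eq_monomial, MvPolynomial.coeff_monomial, if_neg]
    rintro rfl
    fin_cases i <;> simp at hm
  have hx : ∀ m : Fin 2 →₀ ℕ, m 0 < n → m 1 < n + 1 → g.coeff m = 0 := by
    intro m h0 h1
    have := h (Finsupp.single 0 3 + 3 • m) (by simp; omega) (by simp; omega)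
    rw [MvPolynomial.coeff_add, MvPolynomial.coeff_C_mul, hne _ 0 _ (by simp; omega), add_mul,
      MvPolynomial.coeff_add, MvPolynomial.X_pow_eq_monomial, MvPolynomial.coeff_monomial_mul,
      coeff_cube_smul, MvPolynomial.X_pow_eq_monomial, MvPolynomial.coeff_monomial_mul'] at this
    split_ifs at this with hle
    · rw [Finsupp.single_le_iff] at hle
      rw [coeff_cube_of_not_dvd (i := 1) _ (by simp at hle ⊢; omega)] at this
      simpa using this
    · simpa using this
  have hy : ∀ m : Fin 2 →₀ ℕ, m 0 < n + 1 → m 1 < n → g.coeff m = 0 := by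
    intro m h0 h1
    have := h (Finsupp.single 1 4 + 3 • m) (by simp; omega) (by simp; omega)
    rw [MvPolynomial.coeff_add, MvPolynomial.coeff_C_mul, hne _ 0 _ (by simp; omega), add_mul,
      MvPolynomial.coeff_add, MvPolynomial.X_pow_eq_monomial, MvPolynomial.coeff_monomial_mul',
      MvPolynomial.X_pow_eq_monomial, MvPolynomial.coeff_monomial_mul, coeff_cube_smul] at this
    split_ifs at this with hle
    · rw [coeff_cube_of_not_dvd (i := 1) _ (by simp; omega)] at this
      simpa using this
    · simpa using this
  refine ⟨g.coeff (Finsupp.single 0 n + Finsupp.single 1 n), ?_⟩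
  rw [mem_polyPowIdeal_iff]
  intro m h0 h1
  rw [MvPolynomial.coeff_sub, MvPolynomial.coeff_C_mul]
  by_cases hm0 : m 0 = n
  · by_cases hm1 : m 1 = n
    · have : m = Finsupp.single 0 n + Finsupp.single 1 n := by
        ext i; fin_cases i <;> simp [hm0, hm1]
      rw [this, X_mul_X_pow_eq_monomial, MvPolynomial.coeff_monomial]
      simp
    · rw [hne m 1 n hm1, hy m h0 (by omega)]; simp
  · rw [hne m 0 n hm0, hx m (by omega) h1]; simp

/-- The ideal `(x^n, y^n)` of `R`. -/
abbrev powIdeal (k : Type) [Field k] (n : ℕ) : Ideal (Rq k (fRDP k)) :=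
  Ideal.span {xR k (fRDP k) ^ n, yR k (fRDP k) ^ n}

/-- The `k`-algebra map `k[x,y] → R`. -/
def polyToR (k : Type) [Field k] : MvPolynomial (Fin 2) k →ₐ[k] Rq k (fRDP k) :=
  MvPolynomial.aeval ![xR k (fRDP k), yR k (fRDP k)]

theorem polyToR_X_zero (k : Type) [Field k] :
    polyToR k (MvPolynomial.X 0) = xR k (fRDP k) := by simp [polyToR]

theorem polyToR_X_one (k : Type) [Field k] :
    polyToR k (MvPolynomial.X 1) = yR k (fRDP k) := by simp [polyToR]

theorem polyToR_C {k : Type} [Field k] (a : k) :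
    polyToR k (MvPolynomial.C a) = algebraMap k (Rq k (fRDP k)) a := by simp [polyToR]

theorem zR_sq (k : Type) [Field k] :
    zR k (fRDP k) ^ 2 = -(xR k (fRDP k) ^ 3 + yR k (fRDP k) ^ 4) := by
  rw [eq_neg_iff_add_eq_zero, ← add_assoc]
  exact Ideal.Quotient.eq_zero_iff_mem.mpr (Ideal.mem_span_singleton_self (fRDP k))

theorem polyToR_mem_powIdeal {k : Type} [Field k] {n : ℕ} {g : MvPolynomial (Fin 2) k}
    (h : g ∈ polyPowIdeal k n) : polyToR k g ∈ powIdeal k n := by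
  have := Ideal.mem_map_of_mem (polyToR k) h
  rwa [Ideal.map_span, Set.image_pair, map_pow, map_pow, polyToR_X_zero, polyToR_X_one] at this

open scoped MvPowerSeries.WithPiTopology in
/-- Evaluation of power series at nilpotent elements. -/
theorem exists_powerSeries_eval {k S : Type} [Field k] [CommRing S] [Algebra k S]
    (v : Fin 3 → S) (hv : ∀ i, IsNilpotent (v i)) :
    ∃ φ : PS k →ₐ[k] S, ∀ i, φ (X i) = v i := by
  let _ : UniformSpace k := ⊥
  let _ : UniformSpace S := ⊥
  have : DiscreteTopology k := ⟨rfl⟩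
  have : DiscreteTopology S := ⟨rfl⟩
  have : DiscreteUniformity k := ⟨rfl⟩
  have : DiscreteUniformity S := ⟨rfl⟩
  have : ContinuousSMul k S := ⟨continuous_of_discreteTopology⟩
  have hv' : MvPowerSeries.HasEval v := by
    refine ⟨fun i => ?_, by simp [Filter.cofinite_eq_bot]⟩
    obtain ⟨n, hn⟩ := hv i
    refine tendsto_const_nhds.congr' ?_
    filter_upwards [Filter.eventually_ge_atTop n] with m hm
    exact (pow_eq_zero_of_le hm hn).symm
  refine ⟨MvPowerSeries.aeval hv', fun i => ?_⟩
  rw [MvPowerSeries.coe_aeval, MvPowerSeries.eval₂_X]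

theorem eq_zero_of_add_omega_mul_eq_zero {S : Type} [CommRing S] {a b u v : S}
    (h : algebraMap S (QuadraticAlgebra S a b) u +
      QuadraticAlgebra.omega * algebraMap S (QuadraticAlgebra S a b) v = 0) : u = 0 ∧ v = 0 := by
  have hre := congrArg QuadraticAlgebra.re h
  have him := congrArg QuadraticAlgebra.im h
  simp at hre him
  exact ⟨hre, him⟩

/-- The representation `g₀ + z g₁` of elements of `R` is unique modulo `(x^n, y^n)`. -/
theorem mem_polyPowIdeal_of_add_mem {k : Type} [Field k] {n : ℕ} {g₀ g₁ : MvPolynomial (Fin 2) k}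
    (h : polyToR k g₀ + zR k (fRDP k) * polyToR k g₁ ∈ powIdeal k n) :
    g₀ ∈ polyPowIdeal k n ∧ g₁ ∈ polyPowIdeal k n := by
  let S := MvPolynomial (Fin 2) k ⧸ polyPowIdeal k n
  let x : S := Ideal.Quotient.mk _ (MvPolynomial.X 0)
  let y : S := Ideal.Quotient.mk _ (MvPolynomial.X 1)
  have hx : x ^ n = 0 := Ideal.Quotient.eq_zero_iff_mem.mpr (Ideal.subset_span (by simp))
  have hy : y ^ n = 0 := Ideal.Quotient.eq_zero_iff_mem.mpr (Ideal.subset_span (by simp))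
  let Q := QuadraticAlgebra S (-(x ^ 3 + y ^ 4)) 0
  let xQ : Q := algebraMap S Q x
  let yQ : Q := algebraMap S Q y
  let ω : Q := QuadraticAlgebra.omega
  have hxQ : xQ ^ n = 0 := by rw [← map_pow, hx, map_zero]
  have hyQ : yQ ^ n = 0 := by rw [← map_pow, hy, map_zero]
  have hω : ω ^ 2 = -(xQ ^ 3 + yQ ^ 4) := by
    have hxy : -(xQ ^ 3 + yQ ^ 4) = algebraMap S Q (-(x ^ 3 + y ^ 4)) := by
      rw [map_neg, map_add, map_pow, map_pow]
    rw [pow_two, QuadraticAlgebra.omega_mul_omega_eq_mk, hxy]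
    rfl
  have hnil : ∀ i, IsNilpotent (![xQ, yQ, ω] i) := by
    have hx' : IsNilpotent xQ := ⟨n, hxQ⟩
    have hy' : IsNilpotent yQ := ⟨n, hyQ⟩
    have hω' : IsNilpotent ω := by
      rw [← IsNilpotent.pow_iff_pos two_ne_zero, hω, isNilpotent_neg_iff]
      exact (Commute.all _ _).isNilpotent_add (hx'.pow_of_pos three_ne_zero)
        (hy'.pow_of_pos four_ne_zero)
    intro i
    fin_cases i <;> assumption
  obtain ⟨φ, hφ⟩ := exists_powerSeries_eval (k := k) _ hnil
  have h0 : φ (X 0) = xQ := hφ 0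
  have h1 : φ (X 1) = yQ := hφ 1
  have h2 : φ (X 2) = ω := hφ 2
  have hf : ∀ a ∈ Ideal.span {fRDP k}, φ a = 0 := by
    intro a ha
    obtain ⟨b, rfl⟩ := Ideal.mem_span_singleton'.mp ha
    rw [map_mul, map_add, map_add, map_pow, map_pow, map_pow, h0, h1, h2, hω]
    ring
  let ψ : Rq k (fRDP k) →ₐ[k] Q := Ideal.Quotient.liftₐ _ φ hf
  have ψx : ψ (xR k (fRDP k)) = xQ := h0
  have ψy : ψ (yR k (fRDP k)) = yQ := h1
  have ψz : ψ (zR k (fRDP k)) = ω := h2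
  have hker : powIdeal k n ≤ RingHom.ker ψ := by
    rw [Ideal.span_le]
    rintro a (rfl | rfl)
    · simp [RingHom.mem_ker, ψx, hxQ]
    · simp [RingHom.mem_ker, ψy, hyQ]
  have hcomp : ∀ g, ψ (polyToR k g) = algebraMap S Q (Ideal.Quotient.mk _ g) := by
    intro g
    have : ψ.comp (polyToR k) = (IsScalarTower.toAlgHom k S Q).comp
        (Ideal.Quotient.mkₐ k (polyPowIdeal k n)) := by
      refine MvPolynomial.algHom_ext fun i => ?_
      fin_cases i
      · exact (congrArg ψ (polyToR_X_zero k)).trans ψx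
      · exact (congrArg ψ (polyToR_X_one k)).trans ψy
    exact DFunLike.congr_fun this g
  have hz := hker h
  rw [RingHom.mem_ker, map_add, map_mul, ψz, hcomp, hcomp] at hz
  obtain ⟨hre, him⟩ := eq_zero_of_add_omega_mul_eq_zero hz
  exact ⟨Ideal.Quotient.eq_zero_iff_mem.mp hre, Ideal.Quotient.eq_zero_iff_mem.mp him⟩

theorem exists_eq_add_X_mul {k : Type} [Field k] (r : PS k) :
    ∃ (c : k) (r₀ r₁ r₂ : PS k), r = C c + X 0 * r₀ + X 1 * r₁ + X 2 * r₂ := by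
  classical
  let part (s : Set (Fin 3 →₀ ℕ)) : PS k := fun m => if m ∈ s then coeff m r else 0
  have hpart : ∀ s m, coeff m (part s) = if m ∈ s then coeff m r else 0 := fun s m => rfl
  have hd : ∀ i s, (∀ m ∈ s, m i ≠ 0) → X i ∣ part s := by
    intro i s hs
    rw [MvPowerSeries.X_dvd_iff]
    intro m hm
    rw [hpart, if_neg fun h => hs m h hm]
  obtain ⟨r₀, h₀⟩ := hd 0 {m | m 0 ≠ 0} (by simp)
  obtain ⟨r₁, h₁⟩ := hd 1 {m | m 0 = 0 ∧ m 1 ≠ 0} (by simp)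
  obtain ⟨r₂, h₂⟩ := hd 2 {m | m 0 = 0 ∧ m 1 = 0 ∧ m 2 ≠ 0} (by simp)
  refine ⟨constantCoeff r, r₀, r₁, r₂, ?_⟩
  rw [← h₀, ← h₁, ← h₂]
  ext m
  have hm : m = 0 ↔ m 0 = 0 ∧ m 1 = 0 ∧ m 2 = 0 := by
    rw [Finsupp.ext_iff, Fin.forall_fin_succ, Fin.forall_fin_succ, Fin.forall_fin_one]
    rfl
  simp only [map_add, hpart, MvPowerSeries.coeff_C, Set.mem_ofPred_eq]
  by_cases h0 : m 0 = 0
  · by_cases h1 : m 1 = 0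
    · by_cases h2 : m 2 = 0
      · obtain rfl := hm.mpr ⟨h0, h1, h2⟩
        simp
      · simp [hm, h0, h1, h2]
    · simp [hm, h0, h1]
  · simp [hm, h0]

/-- The ideal `(x, y, z)` of `R`. -/
abbrev xyzIdeal (k : Type) [Field k] : Ideal (Rq k (fRDP k)) :=
  Ideal.span {xR k (fRDP k), yR k (fRDP k), zR k (fRDP k)}

theorem exists_sub_mem_xyzIdeal_pow {k : Type} [Field k] (N : ℕ) (r : Rq k (fRDP k)) :
    ∃ g₀ g₁ : MvPolynomial (Fin 2) k,
      r - (polyToR k g₀ + zR k (fRDP k) * polyToR k g₁) ∈ xyzIdeal k ^ N := by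
  induction N generalizing r with
  | zero => exact ⟨0, 0, by simp⟩
  | succ N ih =>
    obtain ⟨p, rfl⟩ := Ideal.Quotient.mk_surjective r
    obtain ⟨c, r₀, r₁, r₂, rfl⟩ := exists_eq_add_X_mul p
    obtain ⟨a₀, a₁, ha⟩ := ih (Ideal.Quotient.mk _ r₀)
    obtain ⟨b₀, b₁, hb⟩ := ih (Ideal.Quotient.mk _ r₁)
    obtain ⟨c₀, c₁, hc⟩ := ih (Ideal.Quotient.mk _ r₂)
    refine ⟨MvPolynomial.C c + MvPolynomial.X 0 * a₀ + MvPolynomial.X 1 * b₀ -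
      (MvPolynomial.X 0 ^ 3 + MvPolynomial.X 1 ^ 4) * c₁,
      MvPolynomial.X 0 * a₁ + MvPolynomial.X 1 * b₁ + c₀, ?_⟩
    have hC : Ideal.Quotient.mk (Ideal.span {fRDP k}) (C c) = polyToR k (MvPolynomial.C c) := by
      rw [polyToR_C]; rfl
    have hx : xR k (fRDP k) ∈ xyzIdeal k := Ideal.subset_span (by simp)
    have hy : yR k (fRDP k) ∈ xyzIdeal k := Ideal.subset_span (by simp)
    have hz : zR k (fRDP k) ∈ xyzIdeal k := Ideal.subset_span (by simp)
    have key := add_mem (add_mem (Ideal.mul_mem_mul hx ha) (Ideal.mul_mem_mul hy hb))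
      (Ideal.mul_mem_mul hz hc)
    rw [Submodule.pow_succ, Submodule.mul_comm]
    convert key using 1
    simp only [map_add, map_sub, map_mul, map_pow, hC, polyToR_X_zero, polyToR_X_one]
    linear_combination (polyToR k c₁) * zR_sq k

theorem exists_sub_mem_powIdeal {k : Type} [Field k] (n : ℕ) (r : Rq k (fRDP k)) :
    ∃ g₀ g₁ : MvPolynomial (Fin 2) k,
      r - (polyToR k g₀ + zR k (fRDP k) * polyToR k g₁) ∈ powIdeal k n := by
  have hx : xR k (fRDP k) ∈ (powIdeal k n).radical := ⟨n, Ideal.subset_span (by simp)⟩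
  have hy : yR k (fRDP k) ∈ (powIdeal k n).radical := ⟨n, Ideal.subset_span (by simp)⟩
  have hz : zR k (fRDP k) ∈ (powIdeal k n).radical := by
    refine Ideal.mem_radical_of_pow_mem (m := 2) ?_
    rw [zR_sq]
    exact neg_mem (add_mem (Ideal.pow_mem_of_mem _ hx 3 (by norm_num))
      (Ideal.pow_mem_of_mem _ hy 4 (by norm_num)))
  have hle : xyzIdeal k ≤ (powIdeal k n).radical := by
    rw [Ideal.span_le]
    rintro a (rfl | rfl | rfl) <;> assumption
  obtain ⟨N, hN⟩ := Ideal.exists_pow_le_of_le_radical_of_fg hle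
    (Submodule.fg_span (Set.toFinite _))
  obtain ⟨g₀, g₁, h⟩ := exists_sub_mem_xyzIdeal_pow N r
  exact ⟨g₀, g₁, hN h⟩

theorem mul_pow_mem_powIdeal {k : Type} [Field k] {n : ℕ} (j : ℕ) {r : Rq k (fRDP k)}
    (h : r ∈ powIdeal k n) : (xR k (fRDP k) * yR k (fRDP k)) ^ j * r ∈ powIdeal k (n + j) := by
  obtain ⟨u, v, rfl⟩ := Ideal.mem_span_pair.mp h
  exact Ideal.mem_span_pair.mpr
    ⟨u * yR k (fRDP k) ^ j, v * xR k (fRDP k) ^ j, by ring⟩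

/-- `x, y` is a regular sequence on `R`. -/
theorem mem_powIdeal_of_mul_pow_mem {k : Type} [Field k] {n j : ℕ} {r : Rq k (fRDP k)}
    (h : (xR k (fRDP k) * yR k (fRDP k)) ^ j * r ∈ powIdeal k (n + j)) : r ∈ powIdeal k n := by
  obtain ⟨g₀, g₁, hg⟩ := exists_sub_mem_powIdeal n r
  have h' := sub_mem h (mul_pow_mem_powIdeal j hg)
  have h'' : polyToR k ((MvPolynomial.X 0 * MvPolynomial.X 1) ^ j * g₀) + zR k (fRDP k) *
      polyToR k ((MvPolynomial.X 0 * MvPolynomial.X 1) ^ j * g₁) ∈ powIdeal k (n + j) := by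
    convert h' using 1
    simp only [map_mul, map_pow, polyToR_X_zero, polyToR_X_one]
    ring
  obtain ⟨h₀, h₁⟩ := mem_polyPowIdeal_of_add_mem h''
  have := add_mem hg (add_mem (polyToR_mem_powIdeal (mem_polyPowIdeal_of_mul_mem h₀))
    (Ideal.mul_mem_left _ (zR k (fRDP k))
      (polyToR_mem_powIdeal (mem_polyPowIdeal_of_mul_mem h₁))))
  rwa [sub_add_cancel] at this

theorem smul_eq_algebraMap_mul {k : Type} [Field k] {f : PS k} (a : Rq k f) (c : Lloc k f) :
    a • c = algebraMap _ (Lloc k f) a * c :=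
  Algebra.smul_def a c

theorem phiX_mul_pow {k : Type} [Field k] {f : PS k} {t : Localization.Away (xR k f)}
    {n : ℕ} {u : Rq k f} (h : t * algebraMap _ _ (xR k f) ^ n = algebraMap _ _ u) :
    phiX k f t * algebraMap _ (Lloc k f) (xR k f) ^ n = algebraMap _ (Lloc k f) u := by
  have := congrArg (phiX k f) h
  rwa [map_mul, map_pow, phiX, IsLocalization.Away.awayToAwayRight_eq,
    IsLocalization.Away.awayToAwayRight_eq] at this

theorem phiY_mul_pow {k : Type} [Field k] {f : PS k} {t : Localization.Away (yR k f)}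
    {n : ℕ} {u : Rq k f} (h : t * algebraMap _ _ (yR k f) ^ n = algebraMap _ _ u) :
    phiY k f t * algebraMap _ (Lloc k f) (yR k f) ^ n = algebraMap _ (Lloc k f) u := by
  have := congrArg (phiY k f) h
  rwa [map_mul, map_pow, phiY, IsLocalization.Away.awayToAwayLeft_eq,
    IsLocalization.Away.awayToAwayLeft_eq] at this

theorem exists_mul_pow_eq_of_mem_Asub {k : Type} [Field k] {f : PS k} {c : Lloc k f}
    (hc : c ∈ Asub k f) : ∃ (n : ℕ) (u v : Rq k f),
      c * algebraMap _ (Lloc k f) (xR k f * yR k f) ^ n =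
        algebraMap _ (Lloc k f) (u * xR k f ^ n + v * yR k f ^ n) := by
  induction hc using Submodule.span_induction with
  | mem c hc =>
    rcases hc with ⟨t, rfl⟩ | ⟨t, rfl⟩
    · obtain ⟨n, u, h⟩ := IsLocalization.Away.surj (xR k f) t
      refine ⟨n, 0, u, ?_⟩
      simp only [map_mul, map_add, map_pow, map_zero, ← phiX_mul_pow h]
      ring
    · obtain ⟨n, u, h⟩ := IsLocalization.Away.surj (yR k f) t
      refine ⟨n, u, 0, ?_⟩
      simp only [map_mul, map_add, map_pow, map_zero, ← phiY_mul_pow h]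
      ring
  | zero => exact ⟨0, 0, 0, by simp⟩
  | add c d _ _ hc hd =>
    obtain ⟨n, u, v, h⟩ := hc
    obtain ⟨n', u', v', h'⟩ := hd
    refine ⟨n + n', u * yR k f ^ n' + u' * yR k f ^ n, v * xR k f ^ n' + v' * xR k f ^ n, ?_⟩
    simp only [map_mul, map_add, map_pow] at h h' ⊢
    linear_combination (algebraMap _ (Lloc k f) (xR k f) * algebraMap _ (Lloc k f) (yR k f)) ^ n' * h +
      (algebraMap _ (Lloc k f) (xR k f) * algebraMap _ (Lloc k f) (yR k f)) ^ n * h'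
  | smul a c _ hc =>
    obtain ⟨n, u, v, h⟩ := hc
    refine ⟨n, a * u, a * v, ?_⟩
    rw [smul_eq_algebraMap_mul]
    simp only [map_mul, map_add, map_pow] at h ⊢
    linear_combination algebraMap _ (Lloc k f) a * h

theorem mem_Asub_of_mul_pow_eq {k : Type} [Field k] {f : PS k} {c : Lloc k f} {n : ℕ}
    {u v : Rq k f} (h : c * algebraMap _ (Lloc k f) (xR k f * yR k f) ^ n =
      algebraMap _ (Lloc k f) (u * xR k f ^ n + v * yR k f ^ n)) : c ∈ Asub k f := by
  let s : Localization.Away (xR k f) :=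
    IsLocalization.mk' (M := Submonoid.powers (xR k f)) _ v ⟨xR k f ^ n, n, rfl⟩
  let t : Localization.Away (yR k f) :=
    IsLocalization.mk' (M := Submonoid.powers (yR k f)) _ u ⟨yR k f ^ n, n, rfl⟩
  have hs := phiX_mul_pow (n := n) (t := s) (u := v) (by
    rw [← map_pow]; exact IsLocalization.mk'_spec _ v _)
  have ht := phiY_mul_pow (n := n) (t := t) (u := u) (by
    rw [← map_pow]; exact IsLocalization.mk'_spec _ u _)
  have hunit : IsUnit (algebraMap _ (Lloc k f) (xR k f * yR k f) ^ n) :=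
    (IsLocalization.Away.algebraMap_isUnit _).pow n
  have : c = phiY k f t + phiX k f s := by
    refine hunit.mul_right_cancel ?_
    rw [h]
    simp only [map_mul, map_add, map_pow]
    rw [← hs, ← ht]
    ring
  rw [this]
  exact add_mem (Submodule.subset_span (Or.inr ⟨t, rfl⟩)) (Submodule.subset_span (Or.inl ⟨s, rfl⟩))

/-- A fraction `r / (xy)^n` is trivial in local cohomology iff `r ∈ (x^n, y^n)`. -/
theorem mem_Asub_iff {k : Type} [Field k] {c : Lloc k (fRDP k)} {n : ℕ} {r : Rq k (fRDP k)}
    (h : c * algebraMap _ (Lloc k (fRDP k)) (xR k (fRDP k) * yR k (fRDP k)) ^ n =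
      algebraMap _ (Lloc k (fRDP k)) r) : c ∈ Asub k (fRDP k) ↔ r ∈ powIdeal k n := by
  constructor
  · intro hc
    obtain ⟨N, u, v, huv⟩ := exists_mul_pow_eq_of_mem_Asub hc
    have heq : algebraMap _ (Lloc k (fRDP k)) ((xR k (fRDP k) * yR k (fRDP k)) ^ N * r) =
        algebraMap _ (Lloc k (fRDP k)) ((xR k (fRDP k) * yR k (fRDP k)) ^ n *
          (u * xR k (fRDP k) ^ N + v * yR k (fRDP k) ^ N)) := by
      rw [map_mul _ _ r, map_mul _ _ (_ + _), ← h, ← huv, map_pow, map_pow]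
      ring
    obtain ⟨⟨_, M, rfl⟩, hM⟩ := (IsLocalization.eq_iff_exists
      (Submonoid.powers (xR k (fRDP k) * yR k (fRDP k))) _).mp heq
    refine mem_powIdeal_of_mul_pow_mem (j := M + N) ?_
    have hw : u * xR k (fRDP k) ^ N + v * yR k (fRDP k) ^ N ∈ powIdeal k N :=
      Ideal.mem_span_pair.mpr ⟨u, v, rfl⟩
    have hw' := mul_pow_mem_powIdeal (M + n) hw
    rw [pow_add, mul_assoc, ← hM, ← mul_assoc, ← pow_add] at hw'
    convert hw' using 2
    omega
  · intro hr
    obtain ⟨u, v, rfl⟩ := Ideal.mem_span_pair.mp hr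
    exact mem_Asub_of_mul_pow_eq h

theorem zxy_mul (k : Type) [Field k] (f : PS k) :
    zxy k f * algebraMap _ (Lloc k f) (xR k f * yR k f) = algebraMap _ (Lloc k f) (zR k f) := by
  rw [zxy, Localization.mk_eq_mk']
  exact IsLocalization.mk'_spec _ _ _

theorem zxy_cube_mem (k : Type) [Field k] :
    zxy k (fRDP k) ^ 3 ∈ Asub k (fRDP k) := by
  have h : zxy k (fRDP k) ^ 3 *
      algebraMap _ (Lloc k (fRDP k)) (xR k (fRDP k) * yR k (fRDP k)) ^ 3 =
        algebraMap _ (Lloc k (fRDP k)) (zR k (fRDP k) ^ 3) := by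
    rw [← mul_pow, zxy_mul, map_pow]
  rw [mem_Asub_iff h]
  refine Ideal.mem_span_pair.mpr ⟨-zR k (fRDP k), -zR k (fRDP k) * yR k (fRDP k), ?_⟩
  linear_combination -zR k (fRDP k) * zR_sq k

theorem zxy_notMem (k : Type) [Field k] : zxy k (fRDP k) ∉ Asub k (fRDP k) := by
  rw [mem_Asub_iff (n := 1) (by rw [pow_one, zxy_mul])]
  intro h
  have h1 := (mem_polyPowIdeal_of_add_mem (k := k) (n := 1) (g₀ := 0) (g₁ := 1) (by simpa using h)).2
  have := mem_polyPowIdeal_iff.mp h1 0 (by simp) (by simp)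
  simp at this

/-- If the Frobenius image of a class is a multiple of the class of `z/(xy)`, then so is
the class itself. -/
theorem exists_sub_smul_mem_of_cube {k : Type} [Field k] [CharP k 3] {c : Lloc k (fRDP k)} {a : k}
    (h : c ^ 3 - algebraMap k (Rq k (fRDP k)) a • zxy k (fRDP k) ∈ Asub k (fRDP k)) :
    ∃ b : k, c - algebraMap k (Rq k (fRDP k)) b • zxy k (fRDP k) ∈ Asub k (fRDP k) := by
  have : CharP (Rq k (fRDP k)) 3 := by
    have : Nontrivial (Rq k (fRDP k)) := by
      refine nontrivial_of_ne (0 : Rq k (fRDP k)) 1 fun h01 => zxy_notMem k ?_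
      rw [← one_mul (zxy k (fRDP k)), ← map_one (algebraMap (Rq k (fRDP k)) (Lloc k (fRDP k))),
        ← h01, map_zero, zero_mul]
      exact zero_mem _
    exact charP_of_injective_algebraMap (algebraMap k (Rq k (fRDP k))).injective 3
  have : Fact (Nat.Prime 3) := ⟨Nat.prime_three⟩
  obtain ⟨n, r, hr⟩ : ∃ (n : ℕ) (r : Rq k (fRDP k)),
      c * algebraMap _ (Lloc k (fRDP k)) (xR k (fRDP k) * yR k (fRDP k)) ^ (n + 1) =
        algebraMap _ (Lloc k (fRDP k)) r := by
    obtain ⟨n, r, hr⟩ := IsLocalization.Away.surj (xR k (fRDP k) * yR k (fRDP k)) c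
    exact ⟨n, r * (xR k (fRDP k) * yR k (fRDP k)), by rw [pow_succ, ← mul_assoc, hr, ← map_mul]⟩
  obtain ⟨g₀, g₁, hg⟩ := exists_sub_mem_powIdeal (n + 1) r
  have hcube : (c ^ 3 - algebraMap k (Rq k (fRDP k)) a • zxy k (fRDP k)) *
      algebraMap _ (Lloc k (fRDP k)) (xR k (fRDP k) * yR k (fRDP k)) ^ (3 * (n + 1)) =
        algebraMap _ (Lloc k (fRDP k)) (r ^ 3 - algebraMap k (Rq k (fRDP k)) a *
          zR k (fRDP k) * (xR k (fRDP k) * yR k (fRDP k)) ^ (3 * n + 2)) := by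
    rw [smul_eq_algebraMap_mul, map_sub, map_pow, ← hr]
    simp only [map_mul, map_pow, ← zxy_mul]
    ring
  rw [mem_Asub_iff hcube] at h
  have hg3 : (r - (polyToR k g₀ + zR k (fRDP k) * polyToR k g₁)) ^ 3 ∈
      powIdeal k (3 * (n + 1)) := by
    obtain ⟨u, v, huv⟩ := Ideal.mem_span_pair.mp hg
    rw [← huv, add_pow_char]
    exact Ideal.mem_span_pair.mpr ⟨u ^ 3, v ^ 3, by ring⟩
  rw [sub_pow_char, add_pow_char] at hg3
  have hpoly : polyToR k (g₀ ^ 3) + zR k (fRDP k) * polyToR k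
      (-((MvPolynomial.X 0 ^ 3 + MvPolynomial.X 1 ^ 4) * g₁ ^ 3 +
        MvPolynomial.C a * (MvPolynomial.X 0 * MvPolynomial.X 1) ^ (3 * n + 2))) ∈
      powIdeal k (3 * (n + 1)) := by
    convert sub_mem h hg3 using 1
    simp only [map_neg, map_add, map_mul, map_pow, polyToR_X_zero, polyToR_X_one, polyToR_C]
    linear_combination -(zR k (fRDP k) * polyToR k g₁ ^ 3) * zR_sq k
  obtain ⟨h₀, h₁⟩ := mem_polyPowIdeal_of_add_mem hpoly
  obtain ⟨b, hb⟩ := exists_sub_socle_mem (neg_mem_iff.mp h₁)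
  refine ⟨b, ?_⟩
  have hlin : (c - algebraMap k (Rq k (fRDP k)) b • zxy k (fRDP k)) *
      algebraMap _ (Lloc k (fRDP k)) (xR k (fRDP k) * yR k (fRDP k)) ^ (n + 1) =
        algebraMap _ (Lloc k (fRDP k)) (r - algebraMap k (Rq k (fRDP k)) b *
          zR k (fRDP k) * (xR k (fRDP k) * yR k (fRDP k)) ^ n) := by
    rw [smul_eq_algebraMap_mul, map_sub, ← hr]
    simp only [map_mul, map_pow, ← zxy_mul]
    ring
  rw [mem_Asub_iff hlin]
  convert add_mem hg (add_mem (polyToR_mem_powIdeal (mem_polyPowIdeal_of_cube_mem h₀))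
    (Ideal.mul_mem_left _ (zR k (fRDP k)) (polyToR_mem_powIdeal hb))) using 1
  simp only [map_sub, map_mul, map_pow, polyToR_X_zero, polyToR_X_one, polyToR_C]
  ring

/-- For the rational double point `R` of type E6p0 in characteristic 3,
the Frobenius-nilpotent part `H^2_m(R)[F^∞]` of local cohomology `L/A` is the one-dimensional
`k`-vector space spanned by the class of `z/(xy)`, and it is annihilated by Frobenius. -/
theorem localCohomology_E6p0 (k : Type) [Field k] [IsAlgClosed k] [CharP k 3] :
    -- (i) the image of z/(xy) in L does not lie in A
    zxy k (fRDP k) ∉ Asub k (fRDP k) ∧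
    -- (ii) (z/(xy))^3 lies in A
    (zxy k (fRDP k)) ^ 3 ∈ Asub k (fRDP k) ∧
    -- (iii) every Frobenius-nilpotent class is a k-multiple of the class of z/(xy)
    (∀ c : Lloc k (fRDP k), (∃ m : ℕ, c ^ 3 ^ m ∈ Asub k (fRDP k)) →
      ∃ a : k, c - algebraMap k (Rq k (fRDP k)) a • zxy k (fRDP k) ∈ Asub k (fRDP k)) := by
  refine ⟨zxy_notMem k, zxy_cube_mem k, ?_⟩
  rintro c ⟨m, hm⟩
  induction m generalizing c with
  | zero =>
    refine ⟨0, ?_⟩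
    rw [map_zero, smul_eq_algebraMap_mul, map_zero, zero_mul, sub_zero]
    simpa using hm
  | succ m ih =>
    rw [pow_succ', pow_mul] at hm
    obtain ⟨a, ha⟩ := ih _ hm
    exact exists_sub_smul_mem_of_cube ha
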